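/- Let E be a real Banach space, T > 0, 0 < α₀ < 1, 0 < μ < 1, r ≥ 1, N ≥ 2, and consider the graded mesh t_n = T(n/N)^r with step sizes τ_n = t_n − t_{n−1} and the associated Peano kernels K(s;θ). Let v : (0,T] → E be twice continuously differentiable with ‖v'(t)‖ ≤ C_v t^{α₀−1} and ‖v''(t)‖ ≤ C_v t^{α₀−2} for all t ∈ (0,T], and let 𝒦 : (0,T] → ℝ be measurable with |𝒦(t)| ≤ C₀ t^{−μ}. Define (R̃₂)¹ = ∫_0^{t₁} 𝒦(t₁ − s)(∫_{t₁}^{s} v'(θ) dθ) ds and, for 2 ≤ n ≤ N, (R̃₂)ⁿ = ∫_0^{t₁} 𝒦(t_n − s)(∫_{t₁}^{s} v'(θ) dθ) ds + Σ_{j=2}^{n} ∫_{t_{j−1}}^{t_j} 𝒦(t_n − s)(∫_{t_{j−1}}^{t_j} K(s;θ) v''(θ) dθ) ds. Then there exists C, depending only on r, α₀, μ, T, C_v, C₀, such that ‖(R̃₂)¹‖ ≤ C N^{−r(1+α₀−μ)} and, for 2 ≤ n ≤ N, ‖(R̃₂)ⁿ‖ ≤ C t_n^{−α₀} [ N^{−min{r(1+2α₀−μ),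 2}} + Φ^N(α₀,μ,r) ], where Φ^N(α₀,μ,r) = N^{−min{r(1+2α₀−μ), 2}} if r(1+α₀) > 2, Φ^N(α₀,μ,r) = N^{−min{r(1+2α₀−μ), r(1+α₀)}} ln N if r(1+α₀) = 2, and Φ^N(α₀,μ,r) = N^{−min{r(1+2α₀−μ), r(1+α₀)}} if r(1+α₀) < 2. -/

import Mathlib

open MeasureTheory intervalIntegral

/-- The graded temporal mesh `t_n = T (n/N)^r`. -/
noncomputable def gm (T r : ℝ) (N n : ℕ) : ℝ := T * ((n : ℝ) / (N : ℝ)) ^ r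

/-- The Peano kernel of the midpoint-type interpolation quadrature on `[t_{j-1}, t_j]`. -/
noncomputable def peanoK (T r : ℝ) (N j : ℕ) (s θ : ℝ) : ℝ :=
  if θ ≤ s then
    (θ - gm T r N (j - 1)) * (s - gm T r N j) / (gm T r N j - gm T r N (j - 1))
  else
    (θ - gm T r N j) * (s - gm T r N (j - 1)) / (gm T r N j - gm T r N (j - 1))

/-- The quantity `Φ^N(α₀, μ, r)` of the quadrature remainder estimate. -/
noncomputable def Phi (α₀ μ r : ℝ) (N : ℕ) : ℝ :=
  if 2 < r * (1 + α₀) then (N : ℝ) ^ (-(min (r * (1 + 2 * α₀ - μ)) 2))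
  else if r * (1 + α₀) = 2 then
    (N : ℝ) ^ (-(min (r * (1 + 2 * α₀ - μ)) (r * (1 + α₀)))) * Real.log (N : ℝ)
  else (N : ℝ) ^ (-(min (r * (1 + 2 * α₀ - μ)) (r * (1 + α₀))))

theorem rpow_sub_rpow_sub_one_le {a x : ℝ} (ha : 1 ≤ a) (hx : 1 ≤ x) :
    x ^ a - (x - 1) ^ a ≤ a * x ^ (a - 1) := by
  have hx0 : 0 < x := by linarith
  have hinv : x⁻¹ ≤ 1 := inv_le_one_of_one_le₀ hx
  have hb := one_add_mul_self_le_rpow_one_add (s := -x⁻¹) (by linarith) ha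
  have hsplit : (x - 1) ^ a = x ^ a * (1 + -x⁻¹) ^ a := by
    rw [← Real.mul_rpow hx0.le (by linarith)]
    congr 1
    field_simp
    ring
  rw [hsplit, Real.rpow_sub_one hx0.ne', div_eq_mul_inv]
  nlinarith [Real.rpow_nonneg hx0.le a]

theorem mul_rpow_le_rpow_sub_rpow_sub_one {a x : ℝ} (ha0 : 0 ≤ a) (ha1 : a ≤ 1) (hx : 1 ≤ x) :
    a * x ^ (a - 1) ≤ x ^ a - (x - 1) ^ a := by
  have hx0 : 0 < x := by linarith
  have hinv : x⁻¹ ≤ 1 := inv_le_one_of_one_le₀ hx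
  have hb := rpow_one_add_le_one_add_mul_self (s := -x⁻¹) (by linarith) ha0 ha1
  have hsplit : (x - 1) ^ a = x ^ a * (1 + -x⁻¹) ^ a := by
    rw [← Real.mul_rpow hx0.le (by linarith)]
    congr 1
    field_simp
    ring
  rw [hsplit, Real.rpow_sub_one hx0.ne', div_eq_mul_inv]
  nlinarith [Real.rpow_nonneg hx0.le a]

theorem sum_rpow_sub_one_le {a : ℝ} (ha : 0 < a) :
    ∃ C > 0, ∀ n : ℕ, 1 ≤ n → ∑ j ∈ Finset.Icc 1 n, (j : ℝ) ^ (a - 1) ≤ C * (n : ℝ) ^ a := by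
  rcases le_total a 1 with ha1 | ha1
  · refine ⟨a⁻¹, by positivity, fun n hn => ?_⟩
    clear hn
    induction n with
    | zero => simp [Real.zero_rpow ha.ne']
    | succ n ih =>
      rw [Finset.sum_Icc_succ_top (by omega)]
      have h := mul_rpow_le_rpow_sub_rpow_sub_one ha.le ha1
        (x := ((n + 1 : ℕ) : ℝ)) (by push_cast; linarith [n.cast_nonneg (α := ℝ)])
      have h2 : ((n + 1 : ℕ) : ℝ) - 1 = n := by push_cast; ring
      rw [h2] at h
      have h3 := mul_le_mul_of_nonneg_left h (inv_pos.2 ha).le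
      rw [← mul_assoc, inv_mul_cancel₀ ha.ne', one_mul] at h3
      linarith
  · refine ⟨1, one_pos, fun n hn => ?_⟩
    have hn0 : (0 : ℝ) < n := by exact_mod_cast hn
    calc ∑ j ∈ Finset.Icc 1 n, (j : ℝ) ^ (a - 1)
        ≤ ∑ j ∈ Finset.Icc 1 n, (n : ℝ) ^ (a - 1) := by
          refine Finset.sum_le_sum fun j hj => ?_
          have := (Finset.mem_Icc.1 hj).2
          exact Real.rpow_le_rpow j.cast_nonneg (by exact_mod_cast this) (by linarith)
      _ = 1 * (n : ℝ) ^ a := by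
          rw [Finset.sum_const, Nat.card_Icc, nsmul_eq_mul, Real.rpow_sub_one hn0.ne']
          simp
          field_simp

theorem sum_rpow_le_of_lt_neg_one {a : ℝ} (ha : a < -1) :
    ∃ C > 0, ∀ n : ℕ, ∑ j ∈ Finset.Icc 1 n, (j : ℝ) ^ a ≤ C := by
  have hs := Real.summable_nat_rpow.2 ha
  have hnn : ∀ j : ℕ, 0 ≤ (j : ℝ) ^ a := fun j => by positivity
  have hsum : 0 ≤ ∑' j : ℕ, (j : ℝ) ^ a := tsum_nonneg hnn
  refine ⟨∑' j : ℕ, (j : ℝ) ^ a + 1, by linarith, fun n => ?_⟩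
  linarith [hs.sum_le_tsum (Finset.Icc 1 n) fun j _ => hnn j]

theorem sum_rpow_neg_one_le {n N : ℕ} (hn : 1 ≤ n) (hnN : n ≤ N) (hN : 2 ≤ N) :
    ∑ j ∈ Finset.Icc 1 n, (j : ℝ) ^ (-1 : ℝ) ≤ ((Real.log 2)⁻¹ + 1) * Real.log N := by
  have h := harmonic_le_one_add_log n
  rw [harmonic_eq_sum_Icc] at h
  push_cast at h
  have hlog : Real.log n ≤ Real.log N :=
    Real.log_le_log (by exact_mod_cast hn) (by exact_mod_cast hnN)
  have hlog2 : Real.log 2 ≤ Real.log N :=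
    Real.log_le_log (by norm_num) (by exact_mod_cast hN)
  have hl2 : 0 < Real.log 2 := Real.log_pos (by norm_num)
  have h1 : 1 ≤ (Real.log 2)⁻¹ * Real.log N := by
    rw [inv_mul_eq_div, le_div_iff₀ hl2]; linarith
  simp only [Real.rpow_neg_one]
  linarith

theorem rpow_neg_mul_rpow_sub_le {a b x y : ℝ} (hx : 1 ≤ x) (hxy : x ≤ y) :
    y ^ (-a) * x ^ (a - b) ≤ y ^ (-(min a b)) := by
  have hy : 0 < y := by linarith
  rcases le_total a b with h | h
  · rw [min_eq_left h]
    exact mul_le_of_le_one_right (by positivity) (Real.rpow_le_one_of_one_le_of_nonpos hx (by linarith))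
  · rw [min_eq_right h]
    calc y ^ (-a) * x ^ (a - b) ≤ y ^ (-a) * y ^ (a - b) := by
          gcongr
      _ = y ^ (-b) := by rw [← Real.rpow_add hy]; ring_nf

theorem weighted_sum_le_rate (α₀ μ r : ℝ) :
    ∃ C > 0, ∀ N n : ℕ, 2 ≤ N → 1 ≤ n → n ≤ N →
      (N : ℝ) ^ (-(r * (1 + 2 * α₀ - μ))) *
        ((n : ℝ) ^ (r * (1 + 2 * α₀ - μ) - r * (1 + α₀)) *
            ∑ j ∈ Finset.Icc 1 n, (j : ℝ) ^ (r * (1 + α₀) - 3) +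
          (n : ℝ) ^ (r * (1 + 2 * α₀ - μ) - 2)) ≤
        C * ((N : ℝ) ^ (-(min (r * (1 + 2 * α₀ - μ)) 2)) + Phi α₀ μ r N) := by
  unfold Phi
  generalize r * (1 + 2 * α₀ - μ) = q
  generalize r * (1 + α₀) = p
  have key : ∀ N n : ℕ, 1 ≤ n → n ≤ N → ∀ b : ℝ,
      (N : ℝ) ^ (-q) * (n : ℝ) ^ (q - b) ≤ (N : ℝ) ^ (-(min q b)) := fun N n hn hnN b =>
    rpow_neg_mul_rpow_sub_le (by exact_mod_cast hn) (by exact_mod_cast hnN)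
  rcases lt_trichotomy p 2 with hp | hp | hp
  · obtain ⟨C, hC, hS⟩ := sum_rpow_le_of_lt_neg_one (a := p - 3) (by linarith)
    refine ⟨C + 1, by linarith, fun N n hN hn hnN => ?_⟩
    rw [if_neg hp.not_gt, if_neg hp.ne]
    have h2 := key N n hn hnN 2
    have hP := key N n hn hnN p
    have h4 : (N : ℝ) ^ (-q) * (n : ℝ) ^ (q - p) * ∑ j ∈ Finset.Icc 1 n, (j : ℝ) ^ (p - 3) ≤
        (N : ℝ) ^ (-(min q p)) * C := by
      gcongr
      exact hS n
    have h5 : 0 ≤ (N : ℝ) ^ (-(min q p)) := by positivity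
    have h6 : 0 ≤ (N : ℝ) ^ (-(min q 2)) := by positivity
    nlinarith [mul_nonneg hC.le h6]
  · subst hp
    have hl2 : 0 < Real.log 2 := Real.log_pos (by norm_num)
    refine ⟨(Real.log 2)⁻¹ + 1, by positivity, fun N n hN hn hnN => ?_⟩
    rw [if_neg (lt_irrefl _), if_pos rfl]
    have h2 := key N n hn hnN 2
    have hS := sum_rpow_neg_one_le hn hnN hN
    have h4 : (N : ℝ) ^ (-q) * (n : ℝ) ^ (q - 2) * ∑ j ∈ Finset.Icc 1 n, (j : ℝ) ^ (2 - 3 : ℝ) ≤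
        (N : ℝ) ^ (-(min q 2)) * (((Real.log 2)⁻¹ + 1) * Real.log N) := by
      rw [show (2 - 3 : ℝ) = -1 by norm_num]
      gcongr
    have h6 : 0 ≤ (N : ℝ) ^ (-(min q 2)) := by positivity
    have h7 : 0 ≤ (Real.log 2)⁻¹ := by positivity
    nlinarith [mul_nonneg h7 h6]
  · obtain ⟨C, hC, hS⟩ := sum_rpow_sub_one_le (a := p - 2) (by linarith)
    refine ⟨C + 1, by linarith, fun N n hN hn hnN => ?_⟩
    rw [if_pos hp]
    have h2 := key N n hn hnN 2
    have hn0 : (0 : ℝ) < n := by exact_mod_cast hn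
    have h4 : (n : ℝ) ^ (q - p) * ∑ j ∈ Finset.Icc 1 n, (j : ℝ) ^ (p - 3) ≤
        C * (n : ℝ) ^ (q - 2) := by
      have h3 := hS n hn
      rw [show p - 2 - 1 = p - 3 by ring] at h3
      calc _ ≤ (n : ℝ) ^ (q - p) * (C * (n : ℝ) ^ (p - 2)) := by gcongr
        _ = C * ((n : ℝ) ^ (q - p) * (n : ℝ) ^ (p - 2)) := by ring
        _ = _ := by rw [← Real.rpow_add hn0]; ring_nf
    have h6 : 0 ≤ (N : ℝ) ^ (-(min q 2)) := by positivity
    calc _ ≤ (N : ℝ) ^ (-q) * (C * (n : ℝ) ^ (q - 2) + (n : ℝ) ^ (q - 2)) := by gcongr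
      _ = (C + 1) * ((N : ℝ) ^ (-q) * (n : ℝ) ^ (q - 2)) := by ring
      _ ≤ (C + 1) * ((N : ℝ) ^ (-(min q 2)) + (N : ℝ) ^ (-(min q 2))) := by
        gcongr
        linarith

theorem intervalIntegrable_const_sub_rpow {μ : ℝ} (hμ : μ < 1) (a b c : ℝ) :
    IntervalIntegrable (fun s => (c - s) ^ (-μ)) volume a b := by
  have h := (intervalIntegral.intervalIntegrable_rpow' (r := -μ) (a := c - a) (b := c - b)
    (by linarith)).comp_sub_left c
  simpa using h

theorem integral_const_sub_rpow {μ : ℝ} (hμ : μ < 1) (a b c : ℝ) :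
    ∫ s in a..b, (c - s) ^ (-μ) = ((c - a) ^ (1 - μ) - (c - b) ^ (1 - μ)) / (1 - μ) := by
  rw [intervalIntegral.integral_comp_sub_left (fun x => x ^ (-μ)) c,
    integral_rpow (Or.inl (by linarith))]
  ring_nf

theorem integral_const_sub_rpow_nonneg {μ a b c : ℝ} (hab : a ≤ b) (hbc : b ≤ c) :
    0 ≤ ∫ s in a..b, (c - s) ^ (-μ) :=
  intervalIntegral.integral_nonneg hab fun s hs => Real.rpow_nonneg (by linarith [hs.2]) _

theorem integral_const_sub_rpow_le {μ a b c : ℝ} (hμ0 : 0 ≤ μ) (hab : a ≤ b) (hbc : b < c) :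
    ∫ s in a..b, (c - s) ^ (-μ) ≤ (b - a) * (c - b) ^ (-μ) := by
  have h := intervalIntegral.norm_integral_le_of_norm_le_const (a := a) (b := b)
    (f := fun s => (c - s) ^ (-μ)) (C := (c - b) ^ (-μ)) fun s hs => by
      rw [Set.uIoc_of_le hab] at hs
      rw [Real.norm_of_nonneg (Real.rpow_nonneg (by linarith [hs.2]) _)]
      exact Real.rpow_le_rpow_of_nonpos (by linarith) (by linarith [hs.2]) (by linarith)
  rw [abs_of_nonneg (by linarith)] at h
  linarith [le_abs_self (∫ s in a..b, (c - s) ^ (-μ)), Real.norm_eq_abs (∫ s in a..b, (c - s) ^ (-μ))]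

theorem norm_integral_kernel_smul_le {E : Type*} [NormedAddCommGroup E] [NormedSpace ℝ E]
    {K : ℝ → ℝ} {F : ℝ → E} {μ C₀ T M a b c : ℝ} (hμ : μ < 1)
    (hK : ∀ s ∈ Set.Ioc (0 : ℝ) T, |K s| ≤ C₀ * s ^ (-μ))
    (ha : 0 ≤ a) (hab : a ≤ b) (hbc : b ≤ c) (hcT : c ≤ T)
    (hF : ∀ s ∈ Set.Ioc a b, ‖F s‖ ≤ M) :
    ‖∫ s in a..b, K (c - s) • F s‖ ≤ C₀ * M * ∫ s in a..b, (c - s) ^ (-μ) := by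
  rw [← intervalIntegral.integral_const_mul]
  refine intervalIntegral.norm_integral_le_of_norm_le hab ?_
    ((intervalIntegrable_const_sub_rpow hμ a b c).const_mul _)
  have hne : ∀ᵐ s : ℝ, s ≠ c := Measure.ae_ne volume c
  filter_upwards [hne] with s hsc hs
  have hpos : 0 < c - s := sub_pos.2 (lt_of_le_of_ne (hs.2.trans hbc) hsc)
  have hk := hK (c - s) ⟨hpos, by linarith [hs.1]⟩
  rw [norm_smul, Real.norm_eq_abs]
  calc |K (c - s)| * ‖F s‖ ≤ (C₀ * (c - s) ^ (-μ)) * M :=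
        mul_le_mul hk (hF s hs) (norm_nonneg _) ((abs_nonneg _).trans hk)
    _ = C₀ * M * (c - s) ^ (-μ) := by ring

theorem norm_integral_le_of_norm_le_rpow {E : Type*} [NormedAddCommGroup E] [NormedSpace ℝ E]
    {v' : ℝ → E} {α₀ Cv T s t : ℝ} (h0 : 0 < α₀) (hCv : 0 ≤ Cv)
    (hv : ∀ s ∈ Set.Ioc (0 : ℝ) T, ‖v' s‖ ≤ Cv * s ^ (α₀ - 1))
    (hs : 0 < s) (hst : s ≤ t) (htT : t ≤ T) :
    ‖∫ θ in t..s, v' θ‖ ≤ Cv * t ^ α₀ / α₀ := by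
  rw [intervalIntegral.integral_symm, norm_neg]
  calc ‖∫ θ in s..t, v' θ‖ ≤ ∫ θ in s..t, Cv * θ ^ (α₀ - 1) := by
        refine intervalIntegral.norm_integral_le_of_norm_le hst
          (Filter.Eventually.of_forall fun θ hθ => hv θ ⟨hs.trans hθ.1, hθ.2.trans htT⟩)
          ((intervalIntegral.intervalIntegrable_rpow' (by linarith)).const_mul _)
    _ = Cv * ((t ^ α₀ - s ^ α₀) / α₀) := by
        rw [intervalIntegral.integral_const_mul, integral_rpow (Or.inl (by linarith))]
        ring_nf
    _ ≤ Cv * (t ^ α₀ / α₀) := by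
        gcongr
        linarith [Real.rpow_nonneg hs.le α₀]
    _ = _ := by ring

theorem abs_peanoK_le {T r : ℝ} {N j : ℕ} {s θ : ℝ} (hj : gm T r N (j - 1) < gm T r N j)
    (hs : s ∈ Set.Icc (gm T r N (j - 1)) (gm T r N j))
    (hθ : θ ∈ Set.Icc (gm T r N (j - 1)) (gm T r N j)) :
    |peanoK T r N j s θ| ≤ gm T r N j - gm T r N (j - 1) := by
  unfold peanoK
  have hpos : 0 < gm T r N j - gm T r N (j - 1) := sub_pos.2 hj
  obtain ⟨hs1, hs2⟩ := hs
  obtain ⟨hθ1, hθ2⟩ := hθ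
  split_ifs <;> rw [abs_div, abs_of_pos hpos, div_le_iff₀ hpos, abs_mul]
  all_goals
    refine mul_le_mul ?_ ?_ (abs_nonneg _) hpos.le <;> rw [abs_le] <;> constructor <;> linarith

theorem norm_integral_peanoK_smul_le {E : Type*} [NormedAddCommGroup E] [NormedSpace ℝ E]
    {v'' : ℝ → E} {T r α₀ Cv : ℝ} {N j : ℕ} {s : ℝ} (h1 : α₀ ≤ 2) (hCv : 0 ≤ Cv)
    (hv : ∀ s ∈ Set.Ioc (0 : ℝ) T, ‖v'' s‖ ≤ Cv * s ^ (α₀ - 2))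
    (hpos : 0 < gm T r N (j - 1)) (hj : gm T r N (j - 1) < gm T r N j) (hjT : gm T r N j ≤ T)
    (hs : s ∈ Set.Icc (gm T r N (j - 1)) (gm T r N j)) :
    ‖∫ θ in gm T r N (j - 1)..gm T r N j, peanoK T r N j s θ • v'' θ‖ ≤
      Cv * ((gm T r N j - gm T r N (j - 1)) ^ 2 * gm T r N (j - 1) ^ (α₀ - 2)) := by
  have h := intervalIntegral.norm_integral_le_of_norm_le_const
    (a := gm T r N (j - 1)) (b := gm T r N j) (f := fun θ => peanoK T r N j s θ • v'' θ)
    (C := (gm T r N j - gm T r N (j - 1)) * (Cv * gm T r N (j - 1) ^ (α₀ - 2))) fun θ hθ => by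
      rw [Set.uIoc_of_le hj.le] at hθ
      rw [norm_smul, Real.norm_eq_abs]
      have hθ0 : 0 < θ := hpos.trans hθ.1
      refine mul_le_mul (abs_peanoK_le hj hs (Set.Ioc_subset_Icc_self hθ)) ?_ (norm_nonneg _)
        (by linarith)
      refine (hv θ ⟨hθ0, hθ.2.trans hjT⟩).trans ?_
      exact mul_le_mul_of_nonneg_left
        (Real.rpow_le_rpow_of_nonpos hpos hθ.1.le (by linarith)) hCv
  rw [abs_of_pos (by linarith)] at h
  exact h.trans_eq (by ring)

theorem gm_eq {T r : ℝ} (N n : ℕ) : gm T r N n = T * (N : ℝ) ^ (-r) * (n : ℝ) ^ r := by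
  rw [gm, Real.div_rpow n.cast_nonneg N.cast_nonneg, Real.rpow_neg N.cast_nonneg]
  ring

theorem gm_zero {T r : ℝ} (hr : 0 < r) (N : ℕ) : gm T r N 0 = 0 := by
  simp [gm, Real.zero_rpow hr.ne']

theorem gm_pos {T r : ℝ} (hT : 0 < T) {N n : ℕ} (hN : 0 < N) (hn : 0 < n) : 0 < gm T r N n := by
  unfold gm; positivity

theorem gm_strictMono {T r : ℝ} (hT : 0 < T) (hr : 0 < r) {N : ℕ} (hN : 0 < N) :
    StrictMono (gm T r N) := fun m n hmn => by
  unfold gm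
  gcongr

theorem gm_self {T r : ℝ} {N : ℕ} (hN : 0 < N) : gm T r N N = T := by
  have : (N : ℝ) ≠ 0 := by positivity
  simp [gm, this]

theorem gm_step_le {T r : ℝ} (hT : 0 < T) (hr : 1 ≤ r) (N : ℕ) {j : ℕ} (hj : 1 ≤ j) :
    gm T r N j - gm T r N (j - 1) ≤ r * (T * (N : ℝ) ^ (-r)) * (j : ℝ) ^ (r - 1) := by
  have h := rpow_sub_rpow_sub_one_le hr (x := (j : ℝ)) (by exact_mod_cast hj)
  rw [gm_eq, gm_eq, Nat.cast_sub hj, Nat.cast_one, ← mul_sub]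
  calc _ ≤ T * (N : ℝ) ^ (-r) * (r * (j : ℝ) ^ (r - 1)) := by gcongr
    _ = _ := by ring

theorem two_rpow_neg_mul_gm_le {T r : ℝ} (hT : 0 < T) (hr : 0 ≤ r) (N : ℕ) {j : ℕ} (hj : 2 ≤ j) :
    2 ^ (-r) * (T * (N : ℝ) ^ (-r) * (j : ℝ) ^ r) ≤ gm T r N (j - 1) := by
  have hj' : (2 : ℝ) ≤ j := by exact_mod_cast hj
  rw [gm_eq, Nat.cast_sub (by omega), Nat.cast_one]
  have h : (2 : ℝ) ^ (-r) * (j : ℝ) ^ r ≤ ((j : ℝ) - 1) ^ r := by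
    rw [Real.rpow_neg (by norm_num), inv_mul_eq_div, ← Real.div_rpow (by positivity) (by norm_num)]
    exact Real.rpow_le_rpow (by positivity) (by linarith) hr
  calc _ = T * (N : ℝ) ^ (-r) * ((2 : ℝ) ^ (-r) * (j : ℝ) ^ r) := by ring
    _ ≤ _ := by gcongr

theorem gm_step_sq_mul_rpow_le {T r α₀ : ℝ} (hT : 0 < T) (hr : 1 ≤ r) (h1 : α₀ ≤ 2) {N j : ℕ}
    (hN : 0 < N) (hj : 2 ≤ j) :
    (gm T r N j - gm T r N (j - 1)) ^ 2 * gm T r N (j - 1) ^ (α₀ - 2) ≤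
      r ^ 2 * (2 ^ (-r)) ^ (α₀ - 2) * ((T * (N : ℝ) ^ (-r)) ^ α₀ * (j : ℝ) ^ (r * α₀ - 2)) := by
  have hstep := gm_step_le hT hr N (j := j) (by omega)
  have hlow := two_rpow_neg_mul_gm_le hT (by linarith : 0 ≤ r) N hj
  have hh : 0 < T * (N : ℝ) ^ (-r) := by positivity
  have hj0 : (0 : ℝ) < j := by exact_mod_cast (by omega : 0 < j)
  have hnn : 0 ≤ gm T r N j - gm T r N (j - 1) :=
    sub_nonneg.2 ((gm_strictMono hT (by linarith) hN).monotone (by omega))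
  generalize T * (N : ℝ) ^ (-r) = h at *
  calc _ ≤ (r * h * (j : ℝ) ^ (r - 1)) ^ 2 * (2 ^ (-r) * (h * (j : ℝ) ^ r)) ^ (α₀ - 2) := by
        refine mul_le_mul (pow_le_pow_left₀ hnn hstep 2)
          (Real.rpow_le_rpow_of_nonpos (by positivity) hlow (by linarith))
          (Real.rpow_nonneg (le_trans (by positivity) hlow) _) (by positivity)
    _ = r ^ 2 * (2 ^ (-r)) ^ (α₀ - 2) * ((h ^ (2 : ℝ) * h ^ (α₀ - 2)) *
          (((j : ℝ) ^ (r - 1)) ^ (2 : ℝ) * ((j : ℝ) ^ r) ^ (α₀ - 2))) := by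
        rw [Real.mul_rpow (by positivity) (by positivity), Real.mul_rpow hh.le (by positivity),
          Real.rpow_two, Real.rpow_two]
        ring
    _ = _ := by
        rw [← Real.rpow_add hh, ← Real.rpow_mul hj0.le, ← Real.rpow_mul hj0.le,
          ← Real.rpow_add hj0]
        ring_nf

theorem half_gm_le_gm_sub {T r : ℝ} (hT : 0 < T) (hr : 1 ≤ r) {N j n : ℕ} (hjn : 2 * j ≤ n) :
    gm T r N n / 2 ≤ gm T r N n - gm T r N j := by
  have h2 : (j : ℝ) ^ r ≤ (n : ℝ) ^ r / 2 := by
    have hjn' : (2 : ℝ) * j ≤ n := by exact_mod_cast hjn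
    have h3 : (2 : ℝ) ≤ 2 ^ r := by
      simpa using Real.rpow_le_rpow_of_exponent_le (x := 2) (by norm_num) hr
    have h4 : (2 : ℝ) ^ r * (j : ℝ) ^ r ≤ (n : ℝ) ^ r := by
      rw [← Real.mul_rpow (by norm_num) (by positivity)]
      exact Real.rpow_le_rpow (by positivity) hjn' (by linarith)
    nlinarith [Real.rpow_nonneg j.cast_nonneg r]
  rw [gm_eq, gm_eq]
  have hh : 0 ≤ T * (N : ℝ) ^ (-r) := by positivity
  nlinarith

theorem integral_const_sub_rpow_gm_le {T r μ : ℝ} (hT : 0 < T) (hr : 1 ≤ r) (hμ0 : 0 ≤ μ)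
    (hμ1 : μ ≤ 1) {N j n : ℕ} (hN : 0 < N) (hj : 1 ≤ j) (hjn : 2 * j ≤ n) :
    ∫ s in gm T r N (j - 1)..gm T r N j, (gm T r N n - s) ^ (-μ) ≤
      2 * r * ((T * (N : ℝ) ^ (-r)) ^ (1 - μ) * ((n : ℝ) ^ (-(r * μ)) * (j : ℝ) ^ (r - 1))) := by
  have hmono := gm_strictMono hT (by linarith : 0 < r) hN
  have hhalf := half_gm_le_gm_sub (N := N) hT hr hjn
  have hn : 0 < gm T r N n := gm_pos hT hN (by omega)
  have hstep := gm_step_le hT hr N hj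
  refine (integral_const_sub_rpow_le hμ0 (hmono.monotone (by omega))
    (hmono (by omega))).trans ?_
  have hh : 0 < T * (N : ℝ) ^ (-r) := by positivity
  have hpow : (gm T r N n - gm T r N j) ^ (-μ) ≤ 2 * gm T r N n ^ (-μ) := by
    refine (Real.rpow_le_rpow_of_nonpos (by linarith) hhalf (by linarith)).trans ?_
    rw [Real.div_rpow hn.le (by norm_num), div_eq_mul_inv, ← Real.rpow_neg (by norm_num), neg_neg,
      mul_comm]
    gcongr
    simpa using Real.rpow_le_rpow_of_exponent_le (x := 2) (by norm_num) hμ1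
  calc _ ≤ (r * (T * (N : ℝ) ^ (-r)) * (j : ℝ) ^ (r - 1)) * (2 * gm T r N n ^ (-μ)) :=
        mul_le_mul hstep hpow (Real.rpow_nonneg (by linarith) _) (by positivity)
    _ = _ := by
        rw [gm_eq, Real.mul_rpow hh.le (by positivity), ← Real.rpow_mul n.cast_nonneg,
          sub_eq_add_neg 1 μ, Real.rpow_add hh, Real.rpow_one]
        ring_nf

theorem sum_integral_gm_le {T r μ : ℝ} (hT : 0 < T) (hr : 0 < r) (hμ1 : μ < 1) {N n : ℕ}
    (hN : 0 < N) (hn : 2 ≤ n) :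
    ∑ j ∈ Finset.Icc 2 n, ∫ s in gm T r N (j - 1)..gm T r N j, (gm T r N n - s) ^ (-μ) ≤
      gm T r N n ^ (1 - μ) / (1 - μ) := by
  have htel : ∀ m, 1 ≤ m → ∑ j ∈ Finset.Icc 2 m,
      ∫ s in gm T r N (j - 1)..gm T r N j, (gm T r N n - s) ^ (-μ) =
      ∫ s in gm T r N 1..gm T r N m, (gm T r N n - s) ^ (-μ) := by
    intro m hm
    induction m, hm using Nat.le_induction with
    | base => simp
    | succ m hm ih =>
      rw [Finset.sum_Icc_succ_top (by omega), ih, Nat.add_sub_cancel]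
      exact intervalIntegral.integral_add_adjacent_intervals
        (intervalIntegrable_const_sub_rpow hμ1 _ _ _) (intervalIntegrable_const_sub_rpow hμ1 _ _ _)
  have hmono := gm_strictMono hT hr hN
  rw [htel n (by omega), integral_const_sub_rpow hμ1, sub_self,
    Real.zero_rpow (by linarith), sub_zero]
  have h1 := gm_pos (r := r) hT hN one_pos
  have h2 := hmono.monotone (show 1 ≤ n by omega)
  have : 0 < 1 - μ := by linarith
  gcongr
  linarith

theorem rpow_le_two_rpow_abs_mul_rpow {x y e : ℝ} (hx : 0 < x) (hxy : x ≤ y) (hyx : y ≤ 2 * x) :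
    x ^ e ≤ 2 ^ |e| * y ^ e := by
  have hy : 0 < y := hx.trans_le hxy
  rcases le_total 0 e with he | he
  · rw [abs_of_nonneg he]
    exact (Real.rpow_le_rpow hx.le hxy he).trans (le_mul_of_one_le_left (by positivity)
      (Real.one_le_rpow (by norm_num) he))
  · rw [abs_of_nonpos he, Real.rpow_neg (by norm_num), inv_mul_eq_div,
      ← Real.div_rpow hy.le (by norm_num)]
    exact Real.rpow_le_rpow_of_nonpos (by positivity) (by linarith) he

theorem weight_mul_integral_gm_le {T r α₀ μ : ℝ} (hT : 0 < T) (hr : 1 ≤ r) (h1 : α₀ ≤ 2)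
    (hμ0 : 0 ≤ μ) (hμ1 : μ ≤ 1) {N j n : ℕ} (hN : 0 < N) (hj : 2 ≤ j) (hjn : j ≤ n) :
    ((gm T r N j - gm T r N (j - 1)) ^ 2 * gm T r N (j - 1) ^ (α₀ - 2)) *
        (∫ s in gm T r N (j - 1)..gm T r N j, (gm T r N n - s) ^ (-μ)) ≤
      r ^ 2 * (2 ^ (-r)) ^ (α₀ - 2) * (2 * r) * ((T * (N : ℝ) ^ (-r)) ^ (1 + α₀ - μ) *
          ((n : ℝ) ^ (-(r * μ)) * (j : ℝ) ^ (r * (1 + α₀) - 3))) +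
        r ^ 2 * (2 ^ (-r)) ^ (α₀ - 2) * 2 ^ |r * α₀ - 2| *
          ((T * (N : ℝ) ^ (-r)) ^ α₀ * (n : ℝ) ^ (r * α₀ - 2)) *
          (∫ s in gm T r N (j - 1)..gm T r N j, (gm T r N n - s) ^ (-μ)) := by
  have hW := gm_step_sq_mul_rpow_le hT hr h1 hN hj
  have hmono := (gm_strictMono hT (by linarith : 0 < r) hN).monotone
  have hI0 := integral_const_sub_rpow_nonneg (μ := μ) (hmono (show j - 1 ≤ j by omega)) (hmono hjn)
  have hh : 0 < T * (N : ℝ) ^ (-r) := by positivity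
  have hj0 : (0 : ℝ) < j := by exact_mod_cast (by omega : 0 < j)
  have hB : 0 ≤ r ^ 2 * ((2 : ℝ) ^ (-r)) ^ (α₀ - 2) := by positivity
  have hr0 : 0 ≤ r := by linarith
  refine (mul_le_mul_of_nonneg_right hW hI0).trans ?_
  rcases le_or_gt (2 * j) n with h2 | h2
  · have hI := integral_const_sub_rpow_gm_le hT hr hμ0 hμ1 hN (by omega) h2
    refine (mul_le_mul_of_nonneg_left hI (by positivity)).trans
      (le_add_of_le_of_nonneg (le_of_eq ?_) (mul_nonneg (by positivity) hI0))
    generalize T * (N : ℝ) ^ (-r) = h at *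
    rw [show 1 + α₀ - μ = α₀ + (1 - μ) by ring, Real.rpow_add hh,
      show r * (1 + α₀) - 3 = (r * α₀ - 2) + (r - 1) by ring, Real.rpow_add hj0]
    ring
  · have hjn' : (j : ℝ) ≤ n := by exact_mod_cast hjn
    have h2' : (n : ℝ) ≤ 2 * j := by exact_mod_cast h2.le
    have hpow := rpow_le_two_rpow_abs_mul_rpow (e := r * α₀ - 2) hj0 hjn' h2'
    refine le_add_of_nonneg_of_le (by positivity) (mul_le_mul_of_nonneg_right ?_ hI0)
    calc _ ≤ r ^ 2 * (2 ^ (-r)) ^ (α₀ - 2) *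
          ((T * (N : ℝ) ^ (-r)) ^ α₀ * (2 ^ |r * α₀ - 2| * (n : ℝ) ^ (r * α₀ - 2))) := by gcongr
      _ = _ := by ring

theorem norm_first_interval_le {E : Type*} [NormedAddCommGroup E] [NormedSpace ℝ E]
    {T α₀ μ r Cv C₀ : ℝ} (hT : 0 < T) (h0 : 0 < α₀) (hμ1 : μ < 1) (hr : 0 < r)
    (hCv : 0 ≤ Cv) {N n : ℕ} (hn : 1 ≤ n) (hnN : n ≤ N)
    {v' : ℝ → E} {K : ℝ → ℝ}
    (hv' : ∀ s ∈ Set.Ioc (0 : ℝ) T, ‖v' s‖ ≤ Cv * s ^ (α₀ - 1))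
    (hK : ∀ s ∈ Set.Ioc (0 : ℝ) T, |K s| ≤ C₀ * s ^ (-μ)) :
    ‖∫ s in (0 : ℝ)..gm T r N 1, K (gm T r N n - s) • (∫ θ in (gm T r N 1)..s, v' θ)‖ ≤
      C₀ * (Cv * gm T r N 1 ^ α₀ / α₀) *
        ∫ s in (0 : ℝ)..gm T r N 1, (gm T r N n - s) ^ (-μ) := by
  have hN : 0 < N := by omega
  have hmono := (gm_strictMono hT hr hN).monotone
  have hT1 : gm T r N n ≤ T := (hmono hnN).trans_eq (gm_self hN)
  exact norm_integral_kernel_smul_le hμ1 hK le_rfl (gm_pos hT hN one_pos).le (hmono hn) hT1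
    fun s hs => norm_integral_le_of_norm_le_rpow h0 hCv hv' hs.1 hs.2 ((hmono hn).trans hT1)

theorem norm_remainder_le {E : Type*} [NormedAddCommGroup E] [NormedSpace ℝ E]
    {T α₀ μ r Cv C₀ : ℝ} (hT : 0 < T) (h0 : 0 < α₀) (h1 : α₀ ≤ 2)
    (hμ0 : 0 ≤ μ) (hμ1 : μ < 1) (hr : 1 ≤ r) (hCv : 0 ≤ Cv) (hC₀ : 0 ≤ C₀)
    {N n : ℕ} (hn : 2 ≤ n) (hnN : n ≤ N) {v' v'' : ℝ → E} {K : ℝ → ℝ}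
    (hv' : ∀ s ∈ Set.Ioc (0 : ℝ) T, ‖v' s‖ ≤ Cv * s ^ (α₀ - 1))
    (hv'' : ∀ s ∈ Set.Ioc (0 : ℝ) T, ‖v'' s‖ ≤ Cv * s ^ (α₀ - 2))
    (hK : ∀ s ∈ Set.Ioc (0 : ℝ) T, |K s| ≤ C₀ * s ^ (-μ)) :
    ‖(∫ s in (0 : ℝ)..gm T r N 1, K (gm T r N n - s) • (∫ θ in (gm T r N 1)..s, v' θ)) +
        ∑ j ∈ Finset.Icc 2 n,
          ∫ s in gm T r N (j - 1)..gm T r N j, K (gm T r N n - s) •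
            (∫ θ in gm T r N (j - 1)..gm T r N j, peanoK T r N j s θ • v'' θ)‖ ≤
      C₀ * Cv * (2 * r / α₀ + r ^ 2 * (2 ^ (-r)) ^ (α₀ - 2) * (2 * r) +
          r ^ 2 * (2 ^ (-r)) ^ (α₀ - 2) * 2 ^ |r * α₀ - 2| / (1 - μ)) *
        ((T * (N : ℝ) ^ (-r)) ^ (1 + α₀ - μ) *
          ((n : ℝ) ^ (-(r * μ)) * ∑ j ∈ Finset.Icc 1 n, (j : ℝ) ^ (r * (1 + α₀) - 3) +
            (n : ℝ) ^ (r * α₀ - 2 + r * (1 - μ)))) := by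
  have hN : 0 < N := by omega
  have hr0 : 0 < r := by linarith
  have hsm := gm_strictMono hT hr0 hN
  have hnT : gm T r N n ≤ T := (hsm.monotone hnN).trans_eq (gm_self hN)
  have hh : 0 < T * (N : ℝ) ^ (-r) := by positivity
  have hn0 : (0 : ℝ) < n := by exact_mod_cast (by omega : 0 < n)
  have hμ : 0 < 1 - μ := by linarith
  have hfirst : ‖∫ s in (0 : ℝ)..gm T r N 1,
      K (gm T r N n - s) • (∫ θ in (gm T r N 1)..s, v' θ)‖ ≤
      C₀ * Cv * (2 * r / α₀ * ((T * (N : ℝ) ^ (-r)) ^ (1 + α₀ - μ) * (n : ℝ) ^ (-(r * μ)))) := by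
    have hI := integral_const_sub_rpow_gm_le hT hr hμ0 hμ1.le hN le_rfl (n := n) (by omega)
    rw [Nat.sub_self, gm_zero hr0] at hI
    have hg := gm_pos (r := r) hT hN one_pos
    refine (norm_first_interval_le hT h0 hμ1 hr0 hCv (by omega) hnN hv' hK).trans
      ((mul_le_mul_of_nonneg_left hI (by positivity)).trans_eq ?_)
    rw [gm_eq, Nat.cast_one, Real.one_rpow, Real.one_rpow, mul_one,
      show 1 + α₀ - μ = α₀ + (1 - μ) by ring, Real.rpow_add hh]
    ring
  have hterm : ∀ j ∈ Finset.Icc 2 n, ‖∫ s in gm T r N (j - 1)..gm T r N j, K (gm T r N n - s) •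
      (∫ θ in gm T r N (j - 1)..gm T r N j, peanoK T r N j s θ • v'' θ)‖ ≤
      C₀ * Cv * (r ^ 2 * (2 ^ (-r)) ^ (α₀ - 2) * (2 * r) * ((T * (N : ℝ) ^ (-r)) ^ (1 + α₀ - μ) *
          (n : ℝ) ^ (-(r * μ))) * (j : ℝ) ^ (r * (1 + α₀) - 3) +
        r ^ 2 * (2 ^ (-r)) ^ (α₀ - 2) * 2 ^ |r * α₀ - 2| *
          ((T * (N : ℝ) ^ (-r)) ^ α₀ * (n : ℝ) ^ (r * α₀ - 2)) *
          (∫ s in gm T r N (j - 1)..gm T r N j, (gm T r N n - s) ^ (-μ))) := by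
    intro j hj
    obtain ⟨hj2, hjn⟩ := Finset.mem_Icc.1 hj
    have hlt := hsm (show j - 1 < j by omega)
    have hp := gm_pos (r := r) hT hN (show 0 < j - 1 by omega)
    refine (norm_integral_kernel_smul_le hμ1 hK hp.le hlt.le (hsm.monotone hjn) hnT fun s hs =>
      norm_integral_peanoK_smul_le h1 hCv hv'' hp hlt ((hsm.monotone hjn).trans hnT)
        (Set.Ioc_subset_Icc_self hs)).trans ?_
    have hw := mul_le_mul_of_nonneg_left
      (weight_mul_integral_gm_le hT hr h1 hμ0 hμ1.le hN hj2 hjn) (mul_nonneg hC₀ hCv)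
    refine le_trans (le_of_eq ?_) (hw.trans_eq ?_) <;> ring
  have hS1 : 1 ≤ ∑ j ∈ Finset.Icc 1 n, (j : ℝ) ^ (r * (1 + α₀) - 3) := by
    simpa using Finset.single_le_sum (f := fun j : ℕ => (j : ℝ) ^ (r * (1 + α₀) - 3))
      (fun j _ => by positivity) (Finset.mem_Icc.2 ⟨le_rfl, (by omega : 1 ≤ n)⟩)
  have hS2 : ∑ j ∈ Finset.Icc 2 n, (j : ℝ) ^ (r * (1 + α₀) - 3) ≤
      ∑ j ∈ Finset.Icc 1 n, (j : ℝ) ^ (r * (1 + α₀) - 3) :=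
    Finset.sum_le_sum_of_subset_of_nonneg (Finset.Icc_subset_Icc_left (by norm_num))
      fun j _ _ => by positivity
  have hI := sum_integral_gm_le hT hr0 hμ1 hN hn
  have hsum := (norm_sum_le _ _).trans (Finset.sum_le_sum hterm)
  rw [← Finset.mul_sum, Finset.sum_add_distrib, ← Finset.mul_sum, ← Finset.mul_sum] at hsum
  have hgn : gm T r N n ^ (1 - μ) = (T * (N : ℝ) ^ (-r)) ^ (1 - μ) * (n : ℝ) ^ (r * (1 - μ)) := by
    rw [gm_eq, Real.mul_rpow hh.le (by positivity), ← Real.rpow_mul hn0.le]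
  rw [hgn] at hI
  refine (norm_add_le _ _).trans ((add_le_add hfirst hsum).trans ?_)
  rw [← mul_add, mul_assoc (C₀ * Cv)]
  refine mul_le_mul_of_nonneg_left ?_ (mul_nonneg hC₀ hCv)
  rw [Real.rpow_add hn0 (r * α₀ - 2), show 1 + α₀ - μ = α₀ + (1 - μ) by ring, Real.rpow_add hh]
  generalize ∑ j ∈ Finset.Icc 1 n, (j : ℝ) ^ (r * (1 + α₀) - 3) = S at *
  generalize T * (N : ℝ) ^ (-r) = h at *
  have hB : 0 ≤ r ^ 2 * ((2 : ℝ) ^ (-r)) ^ (α₀ - 2) := by positivity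
  generalize r ^ 2 * ((2 : ℝ) ^ (-r)) ^ (α₀ - 2) = B at *
  have hB2 : 0 ≤ (2 : ℝ) ^ |r * α₀ - 2| := by positivity
  generalize (2 : ℝ) ^ |r * α₀ - 2| = B' at *
  have hx : 0 ≤ h ^ α₀ * h ^ (1 - μ) * (n : ℝ) ^ (-(r * μ)) := by positivity
  have e1 : 2 * r / α₀ * (h ^ α₀ * h ^ (1 - μ) * (n : ℝ) ^ (-(r * μ))) ≤
      2 * r / α₀ * (h ^ α₀ * h ^ (1 - μ) * (n : ℝ) ^ (-(r * μ)) * S) :=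
    mul_le_mul_of_nonneg_left (le_mul_of_one_le_right hx hS1) (by positivity)
  have e2 := mul_le_mul_of_nonneg_left hS2
    (show 0 ≤ B * (2 * r) * (h ^ α₀ * h ^ (1 - μ) * (n : ℝ) ^ (-(r * μ))) by positivity)
  have e3 := mul_le_mul_of_nonneg_left hI
    (show 0 ≤ B * B' * (h ^ α₀ * (n : ℝ) ^ (r * α₀ - 2)) by positivity)
  have hS0 : 0 ≤ S := by linarith
  have e4 : 0 ≤ (2 * r / α₀ + B * (2 * r)) *
      (h ^ α₀ * h ^ (1 - μ) * ((n : ℝ) ^ (r * α₀ - 2) * (n : ℝ) ^ (r * (1 - μ)))) := by positivity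
  have e5 : 0 ≤ B * B' / (1 - μ) * (h ^ α₀ * h ^ (1 - μ) * (n : ℝ) ^ (-(r * μ)) * S) := by
    positivity
  refine (add_le_add e1 (add_le_add e2 e3)).trans ?_
  refine le_trans (le_add_of_nonneg_right (add_nonneg e4 e5)) (le_of_eq ?_)
  ring

theorem stmt_15 (T α₀ μ r Cv C₀ : ℝ) (hT : 0 < T) (h0 : 0 < α₀) (h1 : α₀ < 1)
    (hμ0 : 0 < μ) (hμ1 : μ < 1) (hr : 1 ≤ r) :
    ∃ C > 0, ∀ (E : Type) [NormedAddCommGroup E] [NormedSpace ℝ E] [CompleteSpace E],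
      ∀ N : ℕ, 2 ≤ N →
      ∀ (v v' v'' : ℝ → E) (K : ℝ → ℝ),
        (∀ s ∈ Set.Ioc (0:ℝ) T, HasDerivAt v (v' s) s) →
        (∀ s ∈ Set.Ioc (0:ℝ) T, HasDerivAt v' (v'' s) s) →
        ContinuousOn v'' (Set.Ioc 0 T) →
        (∀ s ∈ Set.Ioc (0:ℝ) T, ‖v' s‖ ≤ Cv * s ^ (α₀ - 1)) →
        (∀ s ∈ Set.Ioc (0:ℝ) T, ‖v'' s‖ ≤ Cv * s ^ (α₀ - 2)) →
        Measurable K →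
        (∀ s ∈ Set.Ioc (0:ℝ) T, |K s| ≤ C₀ * s ^ (-μ)) →
        (‖∫ s in (0:ℝ)..gm T r N 1, K (gm T r N 1 - s) • (∫ θ in (gm T r N 1)..s, v' θ)‖ ≤
            C * (N : ℝ) ^ (-(r * (1 + α₀ - μ)))) ∧
        (∀ n : ℕ, 2 ≤ n → n ≤ N →
          ‖(∫ s in (0:ℝ)..gm T r N 1, K (gm T r N n - s) • (∫ θ in (gm T r N 1)..s, v' θ)) +
              ∑ j ∈ Finset.Icc 2 n,
                ∫ s in gm T r N (j - 1)..gm T r N j, K (gm T r N n - s) •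
                  (∫ θ in gm T r N (j - 1)..gm T r N j, peanoK T r N j s θ • v'' θ)‖ ≤
            C * (gm T r N n) ^ (-α₀) *
              ((N : ℝ) ^ (-(min (r * (1 + 2 * α₀ - μ)) 2)) + Phi α₀ μ r N)) := by
  obtain ⟨C, hC, hrate⟩ := weighted_sum_le_rate α₀ μ r
  have hr0 : 0 < r := by linarith
  have hμ : 0 < 1 - μ := by linarith
  have hM : 0 ≤ 2 * r / α₀ + r ^ 2 * ((2 : ℝ) ^ (-r)) ^ (α₀ - 2) * (2 * r) +
      r ^ 2 * (2 ^ (-r)) ^ (α₀ - 2) * 2 ^ |r * α₀ - 2| / (1 - μ) := by positivity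
  set M := 2 * r / α₀ + r ^ 2 * ((2 : ℝ) ^ (-r)) ^ (α₀ - 2) * (2 * r) +
      r ^ 2 * (2 ^ (-r)) ^ (α₀ - 2) * 2 ^ |r * α₀ - 2| / (1 - μ) with hMdef
  set A := |C₀ * Cv| * T ^ (1 + α₀ - μ) / (α₀ * (1 - μ)) with hA
  set B := |C₀ * Cv| * M * T ^ (1 + 2 * α₀ - μ) * C with hB
  have hA0 : 0 ≤ A := by positivity
  have hB0 : 0 ≤ B := by positivity
  refine ⟨A + B + 1, by positivity, ?_⟩
  intro E _ _ _ N hN v v' v'' K _ _ _ hv' hv'' _ hK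
  have hT' : T ∈ Set.Ioc (0 : ℝ) T := ⟨hT, le_rfl⟩
  have hCv : 0 ≤ Cv := nonneg_of_mul_nonneg_left ((norm_nonneg _).trans (hv' T hT'))
    (Real.rpow_pos_of_pos hT _)
  have hC₀ : 0 ≤ C₀ := nonneg_of_mul_nonneg_left ((abs_nonneg _).trans (hK T hT'))
    (Real.rpow_pos_of_pos hT _)
  have habs : |C₀ * Cv| = C₀ * Cv := abs_of_nonneg (mul_nonneg hC₀ hCv)
  rw [habs] at hA hB
  have hN0 : 0 < N := by omega
  have hNR : (0 : ℝ) < N := by exact_mod_cast hN0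
  have hh : 0 < T * (N : ℝ) ^ (-r) := by positivity
  refine ⟨?_, fun n hn hnN => ?_⟩
  · have hg : gm T r N 1 = T * (N : ℝ) ^ (-r) := by simp [gm_eq]
    refine (norm_first_interval_le hT h0 hμ1 hr0 hCv le_rfl hN0 hv' hK).trans ?_
    rw [integral_const_sub_rpow hμ1, sub_self, Real.zero_rpow hμ.ne', sub_zero, sub_zero, hg]
    have key : C₀ * (Cv * (T * (N : ℝ) ^ (-r)) ^ α₀ / α₀) *
        ((T * (N : ℝ) ^ (-r)) ^ (1 - μ) / (1 - μ)) =
        A * (N : ℝ) ^ (-(r * (1 + α₀ - μ))) := by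
      have e : (T * (N : ℝ) ^ (-r)) ^ α₀ * (T * (N : ℝ) ^ (-r)) ^ (1 - μ) =
          T ^ (1 + α₀ - μ) * (N : ℝ) ^ (-(r * (1 + α₀ - μ))) := by
        rw [← Real.rpow_add hh, Real.mul_rpow hT.le (by positivity), ← Real.rpow_mul hNR.le]
        ring_nf
      rw [hA]
      field_simp
      linear_combination C₀ * Cv * e
    rw [key]
    gcongr
    linarith
  · have hn0 : (0 : ℝ) < n := by exact_mod_cast (by omega : 0 < n)
    refine (norm_remainder_le hT h0 (by linarith) hμ0.le hμ1 hr hCv hC₀ hn hnN hv' hv'' hK).trans ?_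
    rw [← hMdef]
    have hgpos : 0 < gm T r N n := gm_pos hT hN0 (by omega)
    have hfac : (T * (N : ℝ) ^ (-r)) ^ (1 + α₀ - μ) *
          ((n : ℝ) ^ (-(r * μ)) * ∑ j ∈ Finset.Icc 1 n, (j : ℝ) ^ (r * (1 + α₀) - 3) +
            (n : ℝ) ^ (r * α₀ - 2 + r * (1 - μ))) =
        T ^ (1 + 2 * α₀ - μ) * gm T r N n ^ (-α₀) * ((N : ℝ) ^ (-(r * (1 + 2 * α₀ - μ))) *
          ((n : ℝ) ^ (r * (1 + 2 * α₀ - μ) - r * (1 + α₀)) *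
            ∑ j ∈ Finset.Icc 1 n, (j : ℝ) ^ (r * (1 + α₀) - 3) +
          (n : ℝ) ^ (r * (1 + 2 * α₀ - μ) - 2))) := by
      have e0 : (T * (N : ℝ) ^ (-r)) ^ (1 + α₀ - μ) = (T * (N : ℝ) ^ (-r)) ^ (-α₀) *
          (T ^ (1 + 2 * α₀ - μ) * (N : ℝ) ^ (-(r * (1 + 2 * α₀ - μ)))) := by
        rw [show 1 + α₀ - μ = -α₀ + (1 + 2 * α₀ - μ) by ring, Real.rpow_add hh,
          Real.mul_rpow hT.le (by positivity) (z := 1 + 2 * α₀ - μ), ← Real.rpow_mul hNR.le,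
          neg_mul]
      have e1 : (n : ℝ) ^ (-(r * μ)) =
          (n : ℝ) ^ (-(r * α₀)) * (n : ℝ) ^ (r * (1 + 2 * α₀ - μ) - r * (1 + α₀)) := by
        rw [← Real.rpow_add hn0]
        ring_nf
      have e2 : (n : ℝ) ^ (r * α₀ - 2 + r * (1 - μ)) =
          (n : ℝ) ^ (-(r * α₀)) * (n : ℝ) ^ (r * (1 + 2 * α₀ - μ) - 2) := by
        rw [← Real.rpow_add hn0]
        ring_nf
      have e3 : gm T r N n ^ (-α₀) = (T * (N : ℝ) ^ (-r)) ^ (-α₀) * (n : ℝ) ^ (-(r * α₀)) := by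
        rw [gm_eq, Real.mul_rpow hh.le (by positivity), ← Real.rpow_mul hn0.le, mul_neg]
      rw [e0, e1, e2, e3]
      ring
    have hR := hrate N n hN (by omega) hnN
    have hnonneg := le_trans (by positivity) hR
    have hR0 := nonneg_of_mul_nonneg_right hnonneg hC
    rw [hfac]
    calc _ ≤ C₀ * Cv * M * (T ^ (1 + 2 * α₀ - μ) * gm T r N n ^ (-α₀) *
          (C * ((N : ℝ) ^ (-(min (r * (1 + 2 * α₀ - μ)) 2)) + Phi α₀ μ r N))) := by gcongr
      _ = B * gm T r N n ^ (-α₀) *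
          ((N : ℝ) ^ (-(min (r * (1 + 2 * α₀ - μ)) 2)) + Phi α₀ μ r N) := by rw [hB]; ring
      _ ≤ _ := by
        gcongr
        linarith
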